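/- arXiv:2207.12242 — 2 statements merged into one kernel-verified Lean document; each statement's English description precedes it below -/
import Mathlib

section
/- Local energy conservation law for multisymplectic Hamiltonian PDEs: Let N, d ≥ 1, let M and K₁,…,K_d be real N×N skew-symmetric matrices, let S : ℝ^N → ℝ be smooth, and let z : ℝ^d × ℝ → ℝ^N be a smooth solution of M ∂_t z + Σ_{i=1}^d K_i ∂_{x_i} z = ∇S(z). Define E := S(z) − ½ Σ_{i=1}^d ⟨K_i ∂_{x_i} z, z⟩ and F_i := ½ ⟨K_i ∂_t z, z⟩ for i = 1,…,d. Then ∂_t E + Σ_{i=1}^d ∂_{x_i} F_i = 0 on ℝ^d × ℝ. -/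
open Matrix

/-- Partial derivative in the time variable of `u : ℝᵈ × ℝ → ℝ`. -/
noncomputable def pderivT (d : ℕ) (u : (Fin d → ℝ) × ℝ → ℝ) (p : (Fin d → ℝ) × ℝ) : ℝ :=
  deriv (fun s => u (p.1, s)) p.2

/-- Partial derivative in the `i`-th spatial coordinate of `u : ℝᵈ × ℝ → ℝ`. -/
noncomputable def pderivX (d : ℕ) (i : Fin d) (u : (Fin d → ℝ) × ℝ → ℝ)
    (p : (Fin d → ℝ) × ℝ) : ℝ :=
  deriv (fun s => u (Function.update p.1 i s, p.2)) (p.1 i)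

/-- Componentwise time partial derivative of a vector-valued field. -/
noncomputable def pderivTv (d N : ℕ) (z : (Fin d → ℝ) × ℝ → Fin N → ℝ)
    (p : (Fin d → ℝ) × ℝ) : Fin N → ℝ :=
  fun k => pderivT d (fun q => z q k) p

/-- Componentwise spatial partial derivative of a vector-valued field. -/
noncomputable def pderivXv (d N : ℕ) (i : Fin d) (z : (Fin d → ℝ) × ℝ → Fin N → ℝ)
    (p : (Fin d → ℝ) × ℝ) : Fin N → ℝ :=
  fun k => pderivX d i (fun q => z q k) p

/-- The gradient of `S : ℝᴺ → ℝ` in coordinates. -/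
noncomputable def gradS (N : ℕ) (S : (Fin N → ℝ) → ℝ) (v : Fin N → ℝ) : Fin N → ℝ :=
  fun k => deriv (fun s => S (Function.update v k s)) (v k)

theorem pderivT_eq_fderiv {d : ℕ} {u : (Fin d → ℝ) × ℝ → ℝ} {p : (Fin d → ℝ) × ℝ}
    (hu : DifferentiableAt ℝ u p) : pderivT d u p = fderiv ℝ u p (0, 1) := by
  have hc : HasDerivAt (fun s : ℝ => (p.1, s)) ((0 : Fin d → ℝ), (1 : ℝ)) p.2 :=
    (hasDerivAt_const p.2 p.1).prodMk (hasDerivAt_id p.2)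
  exact (hu.hasFDerivAt.comp_hasDerivAt_of_eq p.2 hc rfl).deriv

theorem pderivX_eq_fderiv {d : ℕ} {i : Fin d} {u : (Fin d → ℝ) × ℝ → ℝ}
    {p : (Fin d → ℝ) × ℝ} (hu : DifferentiableAt ℝ u p) :
    pderivX d i u p = fderiv ℝ u p (Pi.single i 1, 0) := by
  have hc : HasDerivAt (fun s : ℝ => (Function.update p.1 i s, p.2))
      ((Pi.single i 1 : Fin d → ℝ), (0 : ℝ)) (p.1 i) :=
    (hasDerivAt_update p.1 i (p.1 i)).prodMk (hasDerivAt_const (p.1 i) p.2)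
  exact (hu.hasFDerivAt.comp_hasDerivAt_of_eq (p.1 i) hc (by simp)).deriv

theorem pderivTv_eq_fderiv {d N : ℕ} {z : (Fin d → ℝ) × ℝ → Fin N → ℝ}
    (hz : Differentiable ℝ z) : pderivTv d N z = fun p => fderiv ℝ z p (0, 1) := by
  ext p k
  rw [pderivTv, pderivT_eq_fderiv (differentiableAt_pi.1 (hz p) k), fderiv_apply (hz p)]
  rfl

theorem pderivXv_eq_fderiv {d N : ℕ} {i : Fin d} {z : (Fin d → ℝ) × ℝ → Fin N → ℝ}
    (hz : Differentiable ℝ z) :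
    pderivXv d N i z = fun p => fderiv ℝ z p (Pi.single i 1, 0) := by
  ext p k
  rw [pderivXv, pderivX_eq_fderiv (differentiableAt_pi.1 (hz p) k), fderiv_apply (hz p)]
  rfl

theorem gradS_dotProduct {N : ℕ} {S : (Fin N → ℝ) → ℝ} {v : Fin N → ℝ}
    (hS : DifferentiableAt ℝ S v) (w : Fin N → ℝ) : gradS N S v ⬝ᵥ w = fderiv ℝ S v w := by
  have hk (k : Fin N) : gradS N S v k = fderiv ℝ S v (Pi.single k 1) :=
    (hS.hasFDerivAt.comp_hasDerivAt_of_eq (v k) (hasDerivAt_update v k (v k)) (by simp)).deriv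
  conv_rhs => rw [pi_eq_sum_univ' w]
  simp [dotProduct, hk, mul_comm, Pi.single]

theorem mulVec_dotProduct_of_transpose_eq_neg {n : Type*} [Fintype n] {A : Matrix n n ℝ}
    (hA : Aᵀ = -A) (u v : n → ℝ) : A *ᵥ u ⬝ᵥ v = -(A *ᵥ v ⬝ᵥ u) := by
  rw [dotProduct_comm, dotProduct_mulVec, ← mulVec_transpose, hA, neg_mulVec, neg_dotProduct]

theorem HasFDerivAt.mulVec_dotProduct {E n : Type*} [NormedAddCommGroup E] [NormedSpace ℝ E]
    [Fintype n] (A : Matrix n n ℝ) {u v : E → n → ℝ} {u' v' : E →L[ℝ] n → ℝ} {p : E}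
    (hu : HasFDerivAt u u' p) (hv : HasFDerivAt v v' p) :
    ∃ L : E →L[ℝ] ℝ, HasFDerivAt (fun q => A *ᵥ u q ⬝ᵥ v q) L p ∧
      ∀ w, L w = A *ᵥ u' w ⬝ᵥ v p + A *ᵥ u p ⬝ᵥ v' w := by
  classical
  have h := (Matrix.toLinearMap₂' ℝ Aᵀ).toContinuousBilinearMap.hasFDerivAt_of_bilinear hu hv
  have hB (x y : n → ℝ) :
      (Matrix.toLinearMap₂' ℝ Aᵀ).toContinuousBilinearMap x y = A *ᵥ x ⬝ᵥ y := by
    simp [Matrix.toLinearMap₂'_apply', dotProduct_mulVec, vecMul_transpose]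
  refine ⟨_, by simpa only [hB] using h, fun w => ?_⟩
  simp [hB, add_comm]

/-- Local energy conservation law for multisymplectic Hamiltonian PDEs
`M ∂_t z + Σ_i K_i ∂_{x_i} z = ∇S(z)`: with `E = S(z) − ½ Σ_i ⟨K_i ∂_{x_i} z, z⟩` and
`F_i = ½ ⟨K_i ∂_t z, z⟩`, one has `∂_t E + Σ_i ∂_{x_i} F_i = 0`. -/
theorem local_energy_conservation (N d : ℕ) (hN : 1 ≤ N) (hd : 1 ≤ d)
    (M : Matrix (Fin N) (Fin N) ℝ) (K : Fin d → Matrix (Fin N) (Fin N) ℝ)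
    (hM : Mᵀ = -M) (hK : ∀ i, (K i)ᵀ = -(K i))
    (S : (Fin N → ℝ) → ℝ) (hS : ContDiff ℝ (⊤ : ℕ∞) S)
    (z : (Fin d → ℝ) × ℝ → Fin N → ℝ) (hz : ContDiff ℝ (⊤ : ℕ∞) z)
    (heq : ∀ p, M.mulVec (pderivTv d N z p) + (∑ i, (K i).mulVec (pderivXv d N i z p))
        = gradS N S (z p)) :
    ∀ p, pderivT d
        (fun q => S (z q) - (1/2) * ∑ i, (K i).mulVec (pderivXv d N i z q) ⬝ᵥ z q) p
      + (∑ i, pderivX d i (fun q => (1/2) * ((K i).mulVec (pderivTv d N z q) ⬝ᵥ z q)) p)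
      = 0 := by
  intro p
  have hzd : Differentiable ℝ z := hz.differentiable (by simp)
  have hdz : Differentiable ℝ (fderiv ℝ z) :=
    (hz.fderiv_right (m := 1) (WithTop.coe_le_coe.2 le_top)).differentiable (by simp)
  have hSd : Differentiable ℝ S := hS.differentiable (by simp)
  have hsymm : IsSymmSndFDerivAt ℝ z p :=
    hz.contDiffAt.isSymmSndFDerivAt (by simpa using WithTop.coe_le_coe.2 (le_top (a := (2 : ℕ∞))))
  have hdir (w : (Fin d → ℝ) × ℝ) := (hdz p).hasFDerivAt.clm_apply (hasFDerivAt_const w p)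
  simp only [pderivTv_eq_fderiv hzd, pderivXv_eq_fderiv hzd] at heq ⊢
  choose X hX hX' using fun i => (hdir (Pi.single i 1, 0)).mulVec_dotProduct (K i)
    (hzd p).hasFDerivAt
  choose T hT hT' using fun i => (hdir (0, 1)).mulVec_dotProduct (K i) (hzd p).hasFDerivAt
  have hE := ((hSd (z p)).hasFDerivAt.comp p (hzd p).hasFDerivAt).sub
    ((HasFDerivAt.fun_sum fun i (_ : i ∈ Finset.univ) => hX i).const_mul (1 / 2))
  have hF (i : Fin d) := (hT i).const_mul (1 / 2)
  have hpT := pderivT_eq_fderiv hE.differentiableAt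
  rw [hE.fderiv] at hpT
  have hpX (i : Fin d) := pderivX_eq_fderiv (i := i) (hF i).differentiableAt
  simp only [fun i => (hF i).fderiv] at hpX
  have hS' := gradS_dotProduct (hSd (z p)) (fderiv ℝ z p (0, 1))
  have hM0 := mulVec_dotProduct_of_transpose_eq_neg hM (fderiv ℝ z p (0, 1))
    (fderiv ℝ z p (0, 1))
  rw [← heq p, add_dotProduct, sum_dotProduct] at hS'
  have key (i : Fin d) : T i (Pi.single i 1, 0) = X i (0, 1)
      - 2 * (K i *ᵥ fderiv ℝ z p (Pi.single i 1, 0) ⬝ᵥ fderiv ℝ z p (0, 1)) := by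
    rw [hT', hX', mulVec_dotProduct_of_transpose_eq_neg (hK i) (fderiv ℝ z p (0, 1))]
    simp [hsymm.eq (Pi.single i 1, 0) (0, 1)]
    ring
  refine (congrArg₂ (· + ·) hpT (Finset.sum_congr rfl fun i _ => hpX i)).trans ?_
  simp [key, ← hS', ← Finset.mul_sum, mul_sub, Finset.sum_sub_distrib]
  linarith
end

section
/- Multisymplectic conservation law: Let N, d ≥ 1, let M and K₁,…,K_d be real N×N skew-symmetric matrices, let S : ℝ^N → ℝ be twice continuously differentiable, and let z : ℝ^d × ℝ → ℝ^N be smooth. Let W, V : ℝ^d × ℝ → ℝ^N be smooth solutions of the variational (linearized) equation along z, i.e. M ∂_t W + Σ_{i=1}^d K_i ∂_{x_i} W = D²S(z(x,t))·W and M ∂_t V + Σ_{i=1}^d K_i ∂_{x_i} V = D²S(z(x,t))·V, where D²S(z)·W denotes the vector with components Σ_k (∂²S/∂z_j ∂z_k)(z) W_k. Then the pre-symplectic densities ω(W,V) := ⟨M W, V⟩ and ϑ_i(W,V) := ⟨K_i W, V⟩ satisfy ∂_t ⟨M W, V⟩ + Σ_{i=1}^d ∂_{x_i} ⟨K_i W,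 V⟩ = 0 on ℝ^d × ℝ. -/
open Matrix

/-- Coordinate partial derivative of `f : ℝᴺ → ℝ`. -/
noncomputable def pderivN (N : ℕ) (k : Fin N) (f : (Fin N → ℝ) → ℝ) (v : Fin N → ℝ) : ℝ :=
  deriv (fun s => f (Function.update v k s)) (v k)

/-- Hessian of `S : ℝᴺ → ℝ` in coordinates: `(∂²S/∂z_j∂z_k)(v)`. -/
noncomputable def hessS (N : ℕ) (S : (Fin N → ℝ) → ℝ) (v : Fin N → ℝ) (j k : Fin N) : ℝ :=
  pderivN N j (fun u => pderivN N k S u) v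

theorem pderivN_eq_fderiv {N : ℕ} {f : (Fin N → ℝ) → ℝ} {v : Fin N → ℝ}
    (hf : DifferentiableAt ℝ f v) (k : Fin N) :
    pderivN N k f v = fderiv ℝ f v (Pi.single k 1) := by
  have hu : HasDerivAt (Function.update v k) (Pi.single k 1) (v k) := hasDerivAt_update v k (v k)
  have hf' : HasFDerivAt f (fderiv ℝ f v) (Function.update v k (v k)) := by
    simpa using hf.hasFDerivAt
  exact (hf'.comp_hasDerivAt (v k) hu).deriv

theorem hessS_eq_fderiv {N : ℕ} {S : (Fin N → ℝ) → ℝ} (hS : ContDiff ℝ 2 S)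
    (v : Fin N → ℝ) (j k : Fin N) :
    hessS N S v j k = fderiv ℝ (fderiv ℝ S) v (Pi.single j 1) (Pi.single k 1) := by
  have hS' : Differentiable ℝ (fderiv ℝ S) :=
    (hS.fderiv_right (m := 1) (by norm_num)).differentiable one_ne_zero
  have hgrad : (fun u => pderivN N k S u) = fun u => fderiv ℝ S u (Pi.single k 1) :=
    funext fun u => pderivN_eq_fderiv (hS.differentiable two_ne_zero u) k
  have happly := (hS' v).hasFDerivAt.clm_apply
    (hasFDerivAt_const (Pi.single k (1 : ℝ) : Fin N → ℝ) v)
  rw [hessS, hgrad, pderivN_eq_fderiv happly.differentiableAt, happly.fderiv]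
  simp

theorem hessS_comm {N : ℕ} {S : (Fin N → ℝ) → ℝ} (hS : ContDiff ℝ 2 S)
    (v : Fin N → ℝ) (j k : Fin N) : hessS N S v j k = hessS N S v k j := by
  rw [hessS_eq_fderiv hS, hessS_eq_fderiv hS]
  exact hS.contDiffAt.isSymmSndFDerivAt (by simp) _ _

/-- Product rule for the skew-symmetric pairing `⟨A w, v⟩` along curves. -/
theorem deriv_mulVec_dotProduct_of_skew {N : ℕ} {A : Matrix (Fin N) (Fin N) ℝ}
    (hA : Aᵀ = -A) {w v : ℝ → Fin N → ℝ} {t : ℝ}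
    (hw : DifferentiableAt ℝ w t) (hv : DifferentiableAt ℝ v t) :
    deriv (fun s => A.mulVec (w s) ⬝ᵥ v s) t
      = A.mulVec (fun k => deriv (fun s => w s k) t) ⬝ᵥ v t
        - A.mulVec (fun k => deriv (fun s => v s k) t) ⬝ᵥ w t := by
  have hw' k := (differentiableAt_pi.1 hw k).hasDerivAt
  have hv' k := (differentiableAt_pi.1 hv k).hasDerivAt
  have hprod : HasDerivAt (fun s => A.mulVec (w s) ⬝ᵥ v s)
      (A.mulVec (fun k => deriv (fun s => w s k) t) ⬝ᵥ v t
        + A.mulVec (w t) ⬝ᵥ fun k => deriv (fun s => v s k) t) t := by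
    simp only [dotProduct, mulVec, ← Finset.sum_add_distrib]
    exact HasDerivAt.fun_sum fun j _ =>
      (HasDerivAt.fun_sum fun k _ => (hw' k).const_mul (A j k)).mul (hv' j)
  rw [hprod.deriv, sub_eq_add_neg, ← neg_dotProduct, ← neg_mulVec, ← hA, mulVec_transpose,
    ← dotProduct_mulVec, dotProduct_comm (A.mulVec (w t))]

theorem pderivT_mulVec_dotProduct {N d : ℕ} {A : Matrix (Fin N) (Fin N) ℝ} (hA : Aᵀ = -A)
    {W V : (Fin d → ℝ) × ℝ → Fin N → ℝ} (hW : Differentiable ℝ W) (hV : Differentiable ℝ V)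
    (p : (Fin d → ℝ) × ℝ) :
    pderivT d (fun q => A.mulVec (W q) ⬝ᵥ V q) p
      = A.mulVec (pderivTv d N W p) ⬝ᵥ V p - A.mulVec (pderivTv d N V p) ⬝ᵥ W p := by
  have hc : DifferentiableAt ℝ (fun s : ℝ => (p.1, s)) p.2 := by fun_prop
  exact deriv_mulVec_dotProduct_of_skew hA ((hW _).comp p.2 hc) ((hV _).comp p.2 hc)

theorem pderivX_mulVec_dotProduct {N d : ℕ} {A : Matrix (Fin N) (Fin N) ℝ} (hA : Aᵀ = -A)
    {W V : (Fin d → ℝ) × ℝ → Fin N → ℝ} (hW : Differentiable ℝ W) (hV : Differentiable ℝ V)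
    (i : Fin d) (p : (Fin d → ℝ) × ℝ) :
    pderivX d i (fun q => A.mulVec (W q) ⬝ᵥ V q) p
      = A.mulVec (pderivXv d N i W p) ⬝ᵥ V p - A.mulVec (pderivXv d N i V p) ⬝ᵥ W p := by
  have hc : DifferentiableAt ℝ (fun s : ℝ => (Function.update p.1 i s, p.2)) (p.1 i) :=
    (hasDerivAt_update p.1 i (p.1 i)).differentiableAt.prodMk (differentiableAt_const _)
  have h := deriv_mulVec_dotProduct_of_skew hA ((hW _).comp (p.1 i) hc) ((hV _).comp (p.1 i) hc)
  simp only [Function.comp_apply, Function.update_eq_self] at h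
  exact h

/-- Multisymplectic conservation law: for `W, V` solutions of the variational equation
`M ∂_t W + Σ_i K_i ∂_{x_i} W = D²S(z)·W` along a smooth `z`, the pre-symplectic densities
satisfy `∂_t ⟨M W, V⟩ + Σ_i ∂_{x_i} ⟨K_i W, V⟩ = 0`. -/
theorem multisymplectic_conservation_law (N d : ℕ) (hN : 1 ≤ N) (hd : 1 ≤ d)
    (M : Matrix (Fin N) (Fin N) ℝ) (K : Fin d → Matrix (Fin N) (Fin N) ℝ)
    (hM : Mᵀ = -M) (hK : ∀ i, (K i)ᵀ = -(K i))
    (S : (Fin N → ℝ) → ℝ) (hS : ContDiff ℝ 2 S)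
    (z W V : (Fin d → ℝ) × ℝ → Fin N → ℝ)
    (hz : ContDiff ℝ (⊤ : ℕ∞) z) (hW : ContDiff ℝ (⊤ : ℕ∞) W) (hV : ContDiff ℝ (⊤ : ℕ∞) V)
    (heqW : ∀ p, M.mulVec (pderivTv d N W p) + (∑ i, (K i).mulVec (pderivXv d N i W p))
        = fun j => ∑ k, hessS N S (z p) j k * W p k)
    (heqV : ∀ p, M.mulVec (pderivTv d N V p) + (∑ i, (K i).mulVec (pderivXv d N i V p))
        = fun j => ∑ k, hessS N S (z p) j k * V p k) :
    ∀ p, pderivT d (fun q => M.mulVec (W q) ⬝ᵥ V q) p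
      + (∑ i, pderivX d i (fun q => (K i).mulVec (W q) ⬝ᵥ V q) p) = 0 := by
  intro p
  have hW' : Differentiable ℝ W := hW.differentiable (by simp)
  have hV' : Differentiable ℝ V := hV.differentiable (by simp)
  simp only [pderivT_mulVec_dotProduct hM hW' hV', fun i =>
    pderivX_mulVec_dotProduct (hK i) hW' hV' i p, Finset.sum_sub_distrib, ← sum_dotProduct]
  rw [sub_add_sub_comm, ← add_dotProduct, ← add_dotProduct, heqW, heqV, sub_eq_zero]
  simp only [dotProduct, Finset.sum_mul]
  rw [Finset.sum_comm]
  refine Finset.sum_congr rfl fun j _ => Finset.sum_congr rfl fun k _ => ?_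
  rw [hessS_comm hS]
  ring
end
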